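/- arXiv:1810.00994 — 2 statements merged into one kernel-verified Lean document; each statement's English description precedes it below -/
import Mathlib

section
/- Let U be a two-qubit unitary (U ∈ U(4), acting on ℂ²⊗ℂ²). Then U belongs to the family L if and only if there exist single-qubit unitaries R₁, S₁, R₂, S₂ ∈ U(2) such that (R₁⊗S₁)U(R₂⊗S₂) belongs to the two-qubit Clifford group C₂. -/
open Matrix Complex
open scoped Matrix Kronecker

noncomputable section

/-- The Pauli matrices σ₀, σ₁, σ₂, σ₃. -/
def σm : Fin 4 → Matrix (Fin 2) (Fin 2) ℂ :=
  ![1, !![0, 1; 1, 0], !![0, -I; I, 0], !![1, 0; 0, -1]]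

/-- The two-qubit Pauli group P₂. -/
def P₂ : Set (Matrix (Fin 2 × Fin 2) (Fin 2 × Fin 2) ℂ) :=
  {M | ∃ (j k : Fin 4) (c : ℂ), (c = 1 ∨ c = -1 ∨ c = I ∨ c = -I) ∧ M = c • (σm j ⊗ₖ σm k)}

/-- The two-qubit Clifford group C₂. -/
def C₂ : Set (Matrix (Fin 2 × Fin 2) (Fin 2 × Fin 2) ℂ) :=
  {U | U ∈ Matrix.unitaryGroup (Fin 2 × Fin 2) ℂ ∧ ∀ g ∈ P₂, U * g * Uᴴ ∈ P₂}

/-- The family L: two-qubit unitaries U for which there is a unitary R such that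
conjugation by U sends each R σ_j R† ⊗ I (j = 1,2,3) to a product unitary T_j ⊗ V_j. -/
def Lfam : Set (Matrix (Fin 2 × Fin 2) (Fin 2 × Fin 2) ℂ) :=
  {U | U ∈ Matrix.unitaryGroup (Fin 2 × Fin 2) ℂ ∧
    ∃ R ∈ Matrix.unitaryGroup (Fin 2) ℂ, ∀ j : Fin 4, j ≠ 0 →
      ∃ T ∈ Matrix.unitaryGroup (Fin 2) ℂ, ∃ V ∈ Matrix.unitaryGroup (Fin 2) ℂ,
        U * ((R * σm j * Rᴴ) ⊗ₖ (1 : Matrix (Fin 2) (Fin 2) ℂ)) * Uᴴ = T ⊗ₖ V}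

abbrev M2 := Matrix (Fin 2) (Fin 2) ℂ
abbrev M4 := Matrix (Fin 2 × Fin 2) (Fin 2 × Fin 2) ℂ

/-- Unitarity as a pair of equations. -/
lemma uni_iff {n : Type*} [Fintype n] [DecidableEq n] {A : Matrix n n ℂ} :
    A ∈ Matrix.unitaryGroup n ℂ ↔ Aᴴ * A = 1 ∧ A * Aᴴ = 1 := by
  rw [Unitary.mem_iff]; rfl

lemma uni_kron {A B : M2} (hA : A ∈ Matrix.unitaryGroup (Fin 2) ℂ)
    (hB : B ∈ Matrix.unitaryGroup (Fin 2) ℂ) :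
    A ⊗ₖ B ∈ Matrix.unitaryGroup (Fin 2 × Fin 2) ℂ := by
  rw [uni_iff] at *
  simp [conjTranspose_kronecker, ← mul_kronecker_mul, hA.1, hA.2, hB.1, hB.2]

lemma uni_conj {n : Type*} [Fintype n] [DecidableEq n] {A : Matrix n n ℂ}
    (hA : A ∈ Matrix.unitaryGroup n ℂ) : Aᴴ ∈ Matrix.unitaryGroup n ℂ :=
  Unitary.star_mem hA

lemma uni_smul {n : Type*} [Fintype n] [DecidableEq n] {A : Matrix n n ℂ} {c : ℂ}
    (hA : A ∈ Matrix.unitaryGroup n ℂ) (hc : star c * c = 1) :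
    c • A ∈ Matrix.unitaryGroup n ℂ := by
  rw [uni_iff] at *
  have hc' : c * star c = 1 := by rw [mul_comm]; exact hc
  simp only [conjTranspose_smul, smul_mul_smul_comm, hA.1, hA.2, hc, hc', one_smul, and_self]

lemma sigma_uni (j : Fin 4) : σm j ∈ Matrix.unitaryGroup (Fin 2) ℂ := by
  rw [uni_iff]
  constructor <;> fin_cases j <;> ext a b <;> fin_cases a <;> fin_cases b <;>
    simp [σm, Matrix.mul_apply, Fin.sum_univ_two]

/-- Scalar Kronecker products have scalar factors. -/
lemma kron_scalar {A B : M2} {c : ℂ} (hc : c ≠ 0) (h : A ⊗ₖ B = c • (1 : M4)) :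
    ∃ a b : ℂ, A = a • 1 ∧ B = b • 1 ∧ a * b = c := by
  have e : ∀ i j k l, A i k * B j l = if i = k ∧ j = l then c else 0 := by
    intro i j k l
    have := congrFun (congrFun h (i, j)) (k, l)
    simpa [Matrix.one_apply, Prod.ext_iff] using this
  have h00 : A 0 0 * B 0 0 = c := by simpa using e 0 0 0 0
  have hA : A 0 0 ≠ 0 := by rintro h; simp [h] at h00; exact hc h00.symm
  have hB : B 0 0 ≠ 0 := by rintro h; simp [h] at h00; exact hc h00.symm
  refine ⟨A 0 0, B 0 0, ?_, ?_, h00⟩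
  · ext i j
    apply mul_right_cancel₀ hB
    rw [e]
    by_cases hij : i = j <;> simp [hij, h00]
  · ext i j
    apply mul_left_cancel₀ hA
    rw [e]
    by_cases hij : i = j <;> simp [hij, h00]

/-- Normalise the two factors of an involutive product to be involutions. -/
lemma normalise {T V : M2} (hT : T ∈ Matrix.unitaryGroup (Fin 2) ℂ)
    (hV : V ∈ Matrix.unitaryGroup (Fin 2) ℂ) (h : (T ⊗ₖ V) * (T ⊗ₖ V) = 1) :
    ∃ T' ∈ Matrix.unitaryGroup (Fin 2) ℂ, ∃ V' ∈ Matrix.unitaryGroup (Fin 2) ℂ,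
      T' * T' = 1 ∧ V' * V' = 1 ∧ T ⊗ₖ V = T' ⊗ₖ V' := by
  rw [← mul_kronecker_mul, ← one_smul ℂ (1 : M4)] at h
  obtain ⟨a, b, ha, hb, hab⟩ := kron_scalar one_ne_zero h
  obtain ⟨s, hs'⟩ := IsAlgClosed.exists_pow_nat_eq b (n := 2) (by norm_num)
  have hs : b = s ^ 2 := hs'.symm
  have hb0 : b ≠ 0 := right_ne_zero_of_mul (hab ▸ one_ne_zero)
  have hs0 : s ≠ 0 := by rintro rfl; simp at hs; exact hb0 hs
  have hbu : star b * b = 1 := by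
    have h2 := (uni_iff.1 (mul_mem hV hV)).1
    rw [hb] at h2
    have := congrFun (congrFun h2 0) 0
    simpa [Matrix.mul_apply, Fin.sum_univ_two] using this
  have hsu : star s * s = 1 := by
    have h1 : (Complex.normSq s) ^ 2 = 1 := by
      have : ((Complex.normSq s ^ 2 : ℝ) : ℂ) = 1 := by
        push_cast
        rw [Complex.normSq_eq_conj_mul_self, ← hbu, hs]
        simp; ring
      exact_mod_cast this
    have h2 : Complex.normSq s = 1 := by
      have := Complex.normSq_nonneg s
      nlinarith
    have : ((Complex.normSq s : ℝ) : ℂ) = 1 := by rw [h2]; simp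
    rw [Complex.normSq_eq_conj_mul_self] at this
    exact this
  have hsi : star s = s⁻¹ := eq_inv_of_mul_eq_one_left hsu
  refine ⟨s • T, uni_smul hT hsu, star s • V, uni_smul hV (by rw [star_star, mul_comm]; exact hsu),
    ?_, ?_, ?_⟩
  · rw [smul_mul_smul_comm, ha, smul_smul, ← sq, ← hs, mul_comm, hab, one_smul]
  · rw [smul_mul_smul_comm, hb, smul_smul, hsi, hs]
    have : s⁻¹ * s⁻¹ * s ^ 2 = 1 := by field_simp
    rw [this, one_smul]
  · rw [smul_kronecker, kronecker_smul, smul_smul, mul_comm, hsu, one_smul]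

/-- Spectral lemma for 2 x 2 unitary involutions. -/
lemma spectral {T : M2} (hT : T ∈ Matrix.unitaryGroup (Fin 2) ℂ) (h : T * T = 1) :
    T = 1 ∨ T = -1 ∨ ∃ S ∈ Matrix.unitaryGroup (Fin 2) ℂ, S * T * Sᴴ = σm 3 := by
  have hH : T.IsHermitian := by
    have := (uni_iff.1 hT).1
    calc Tᴴ = Tᴴ * (T * T) := by rw [h, mul_one]
      _ = T := by rw [← mul_assoc, this, one_mul]
  obtain ⟨Q, hQ, d, hd⟩ : ∃ Q ∈ Matrix.unitaryGroup (Fin 2) ℂ, ∃ d : Fin 2 → ℂ,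
      T = Q * diagonal d * Qᴴ :=
    ⟨hH.eigenvectorUnitary, hH.eigenvectorUnitary.2, _, hH.spectral_theorem⟩
  obtain ⟨hQ1, hQ2⟩ := uni_iff.1 hQ
  have hd2 : Qᴴ * T * Q = diagonal d := by
    rw [hd]; simp only [mul_assoc, hQ1, mul_one]; rw [← mul_assoc, hQ1, one_mul]
  have hdd : diagonal d * diagonal d = 1 := by
    rw [← hd2]
    calc Qᴴ * T * Q * (Qᴴ * T * Q) = Qᴴ * T * (Q * Qᴴ) * T * Q := by simp only [mul_assoc]
      _ = Qᴴ * (T * T) * Q := by rw [hQ2]; simp only [mul_assoc, one_mul]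
      _ = 1 := by rw [h, mul_one, hQ1]
  have hi : ∀ i, d i = 1 ∨ d i = -1 := by
    intro i
    have := congrFun (congrFun hdd i) i
    simp at this
    exact mul_self_eq_one_iff.1 this
  rcases hi 0 with h0 | h0 <;> rcases hi 1 with h1 | h1
  · left
    have : diagonal d = (1 : M2) := by
      ext a b; fin_cases a <;> fin_cases b <;> simp [h0, h1]
    rw [hd, this, mul_one, hQ2]
  · right; right
    refine ⟨Qᴴ, uni_conj hQ, ?_⟩
    rw [conjTranspose_conjTranspose, hd2]
    ext a b; fin_cases a <;> fin_cases b <;> simp [h0, h1, σm]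
  · right; right
    refine ⟨σm 1 * Qᴴ, mul_mem (sigma_uni 1) (uni_conj hQ), ?_⟩
    have : σm 1 * Qᴴ * T * (σm 1 * Qᴴ)ᴴ = σm 1 * (Qᴴ * T * Q) * (σm 1)ᴴ := by
      rw [conjTranspose_mul, conjTranspose_conjTranspose]; simp only [mul_assoc]
    rw [this, hd2]
    ext a b; fin_cases a <;> fin_cases b <;>
      simp [h0, h1, σm, Matrix.mul_apply, Fin.sum_univ_two, Matrix.vecMul, dotProduct]
  · right; left
    have : diagonal d = (-1 : M2) := by
      ext a b; fin_cases a <;> fin_cases b <;> simp [h0, h1]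
    rw [hd, this]; simp [hQ2]

lemma uconj_mul {n : Type*} [Fintype n] [DecidableEq n] {S A B : Matrix n n ℂ}
    (hS : S ∈ Matrix.unitaryGroup n ℂ) :
    (S * A * Sᴴ) * (S * B * Sᴴ) = S * (A * B) * Sᴴ := by
  have h := (uni_iff.1 hS).1
  calc (S * A * Sᴴ) * (S * B * Sᴴ) = S * A * (Sᴴ * S) * B * Sᴴ := by simp only [mul_assoc]
    _ = _ := by rw [h]; simp only [mul_assoc, one_mul]

/-- Anticommuting pairs are conjugate to (σ₃, σ₁). -/
lemma anti_pair {A B : M2} (hA : A ∈ Matrix.unitaryGroup (Fin 2) ℂ)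
    (hB : B ∈ Matrix.unitaryGroup (Fin 2) ℂ) (hA2 : A * A = 1) (hB2 : B * B = 1)
    (h : A * B = -(B * A)) :
    ∃ R ∈ Matrix.unitaryGroup (Fin 2) ℂ, R * A * Rᴴ = σm 3 ∧ R * B * Rᴴ = σm 1 := by
  have hB0 : B ≠ -B := by
    intro h
    have h2 : B = 0 := by
      ext i j
      have := congrFun (congrFun h i) j
      simp only [Matrix.neg_apply] at this
      simpa using self_eq_neg.1 this
    rw [h2] at hB2; simp at hB2
  rcases spectral hA hA2 with h1 | h1 | ⟨S, hS, hSA⟩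
  · subst h1; simp at h; exact absurd h hB0
  · subst h1; simp at h; exact absurd h.symm hB0
  set B' := S * B * Sᴴ with hB'
  have hS2 := uni_iff.1 hS
  have hac : σm 3 * B' = -(B' * σm 3) := by
    rw [← hSA, hB', uconj_mul hS, uconj_mul hS, h]; simp
  have hBB : B' * B' = 1 := by rw [hB', uconj_mul hS, hB2, mul_one, hS2.2]
  have hBu : B' ∈ Matrix.unitaryGroup (Fin 2) ℂ := mul_mem (mul_mem hS hB) (uni_conj hS)
  have e00 : B' 0 0 = 0 := by
    have := congrFun (congrFun hac 0) 0
    simp [σm, Matrix.mul_apply, Fin.sum_univ_two] at this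
    exact self_eq_neg.1 this
  have e11 : B' 1 1 = 0 := by
    have := congrFun (congrFun hac 1) 1
    simp [σm, Matrix.mul_apply, Fin.sum_univ_two] at this
    first | exact self_eq_neg.1 this | exact self_eq_neg.1 this.symm
  have e01 : B' 0 1 * B' 1 0 = 1 := by
    have := congrFun (congrFun hBB 0) 0
    simpa [Matrix.mul_apply, Fin.sum_univ_two, e00] using this
  have eu : B' 0 1 * star (B' 0 1) = 1 := by
    have := congrFun (congrFun (uni_iff.1 hBu).2 0) 0
    simpa [Matrix.mul_apply, Fin.sum_univ_two, e00] using this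
  have eu' : (starRingEnd ℂ) (B' 0 1) * B' 0 1 = 1 := by rw [mul_comm]; exact eu
  have eu2 : B' 0 1 * (starRingEnd ℂ) (B' 0 1) = 1 := eu
  set F : M2 := !![1, 0; 0, B' 0 1] with hF
  have hFu : F ∈ Matrix.unitaryGroup (Fin 2) ℂ := by
    rw [uni_iff]
    constructor <;> ext a b <;> fin_cases a <;> fin_cases b <;>
      simp [hF, Matrix.mul_apply, Fin.sum_univ_two, eu', eu2]
  have hr : ∀ X, F * S * X * (F * S)ᴴ = F * (S * X * Sᴴ) * Fᴴ := by
    intro X; rw [conjTranspose_mul]; simp only [mul_assoc]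
  refine ⟨F * S, mul_mem hFu hS, ?_, ?_⟩
  · rw [hr, hSA]
    ext a b; fin_cases a <;> fin_cases b <;>
      simp [hF, σm, Matrix.mul_apply, Fin.sum_univ_two, eu2]
  · rw [hr, ← hB']
    ext a b; fin_cases a <;> fin_cases b <;>
      simp [hF, σm, Matrix.mul_apply, Fin.sum_univ_two, eu2, e00, e11, e01,
        Matrix.vecMul, dotProduct]

lemma diag_invol {B : M2} (hB : B * B = 1) (hc : σm 3 * B = B * σm 3) :
    ∃ e w, (e = (1 : ℂ) ∨ e = -1) ∧ (w = (1 : M2) ∨ w = σm 3) ∧ B = e • w := by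
  have e01 : B 0 1 = 0 := by
    have := congrFun (congrFun hc 0) 1
    simp [σm, Matrix.mul_apply, Fin.sum_univ_two] at this
    exact self_eq_neg.1 this
  have e10 : B 1 0 = 0 := by
    have := congrFun (congrFun hc 1) 0
    simp [σm, Matrix.mul_apply, Fin.sum_univ_two] at this
    first | exact self_eq_neg.1 this | exact self_eq_neg.1 this.symm
  have e0 : B 0 0 = 1 ∨ B 0 0 = -1 := by
    have := congrFun (congrFun hB 0) 0
    simp [Matrix.mul_apply, Fin.sum_univ_two, e01] at this
    exact mul_self_eq_one_iff.1 this
  have e1 : B 1 1 = 1 ∨ B 1 1 = -1 := by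
    have := congrFun (congrFun hB 1) 1
    simp [Matrix.mul_apply, Fin.sum_univ_two, e01] at this
    exact mul_self_eq_one_iff.1 this
  rcases e0 with h0 | h0 <;> rcases e1 with h1 | h1
  · refine ⟨1, 1, by simp, by simp, ?_⟩
    ext a b; fin_cases a <;> fin_cases b <;> simp [σm, e01, e10, h0, h1]
  · refine ⟨1, σm 3, by simp, by simp, ?_⟩
    ext a b; fin_cases a <;> fin_cases b <;> simp [σm, e01, e10, h0, h1]
  · refine ⟨-1, σm 3, by simp, by simp, ?_⟩
    ext a b; fin_cases a <;> fin_cases b <;> simp [σm, e01, e10, h0, h1]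
  · refine ⟨-1, 1, by simp, by simp, ?_⟩
    ext a b; fin_cases a <;> fin_cases b <;> simp [σm, e01, e10, h0, h1]

/-- Commuting pairs are simultaneously conjugate to signed elements of {1, σ₃}. -/
lemma comm_pair {A B : M2} (hA : A ∈ Matrix.unitaryGroup (Fin 2) ℂ)
    (hB : B ∈ Matrix.unitaryGroup (Fin 2) ℂ) (hA2 : A * A = 1) (hB2 : B * B = 1)
    (h : A * B = B * A) :
    ∃ S ∈ Matrix.unitaryGroup (Fin 2) ℂ,
      (∃ e w, (e = (1 : ℂ) ∨ e = -1) ∧ (w = (1 : M2) ∨ w = σm 3) ∧ S * A * Sᴴ = e • w) ∧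
      (∃ e w, (e = (1 : ℂ) ∨ e = -1) ∧ (w = (1 : M2) ∨ w = σm 3) ∧ S * B * Sᴴ = e • w) := by
  have key : ∀ {A B S : M2}, S ∈ Matrix.unitaryGroup (Fin 2) ℂ → B * B = 1 → A * B = B * A →
      S * A * Sᴴ = σm 3 →
      ∃ e w, (e = (1 : ℂ) ∨ e = -1) ∧ (w = (1 : M2) ∨ w = σm 3) ∧ S * B * Sᴴ = e • w := by
    intro A B S hS hB2 h hSA
    apply diag_invol
    · rw [uconj_mul hS, hB2, mul_one, (uni_iff.1 hS).2]
    · rw [← hSA, uconj_mul hS, uconj_mul hS, h]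
  have triv : ∀ {A S : M2}, S ∈ Matrix.unitaryGroup (Fin 2) ℂ → (A = 1 ∨ A = -1) →
      ∃ e w, (e = (1 : ℂ) ∨ e = -1) ∧ (w = (1 : M2) ∨ w = σm 3) ∧ S * A * Sᴴ = e • w := by
    intro A S hS hA
    have := (uni_iff.1 hS).2
    rcases hA with rfl | rfl
    · exact ⟨1, 1, by simp, by simp, by simp [this]⟩
    · exact ⟨-1, 1, by simp, by simp, by simp [this]⟩
  have self : ∀ {A S : M2}, S * A * Sᴴ = σm 3 →
      ∃ e w, (e = (1 : ℂ) ∨ e = -1) ∧ (w = (1 : M2) ∨ w = σm 3) ∧ S * A * Sᴴ = e • w :=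
    fun h => ⟨1, σm 3, by simp, by simp, by simp [h]⟩
  have main : (A = 1 ∨ A = -1) ∨ ∃ S ∈ Matrix.unitaryGroup (Fin 2) ℂ, S * A * Sᴴ = σm 3 := by
    rw [or_assoc]; exact spectral hA hA2
  have main' : (B = 1 ∨ B = -1) ∨ ∃ S ∈ Matrix.unitaryGroup (Fin 2) ℂ, S * B * Sᴴ = σm 3 := by
    rw [or_assoc]; exact spectral hB hB2
  rcases main with h1 | ⟨S, hS, hSA⟩
  · rcases main' with h2 | ⟨S, hS, hSB⟩
    · exact ⟨1, one_mem _, triv (one_mem _) h1, triv (one_mem _) h2⟩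
    · exact ⟨S, hS, triv hS h1, self hSB⟩
  · exact ⟨S, hS, self hSA, key hS hB2 h hSA⟩

/-- The commutant of M₂ ⊗ 1. -/
lemma commutant {N : M4} (hN : N ∈ Matrix.unitaryGroup (Fin 2 × Fin 2) ℂ)
    (h3 : N * (σm 3 ⊗ₖ (1 : M2)) = (σm 3 ⊗ₖ (1 : M2)) * N)
    (h1 : N * (σm 1 ⊗ₖ (1 : M2)) = (σm 1 ⊗ₖ (1 : M2)) * N) :
    ∃ W ∈ Matrix.unitaryGroup (Fin 2) ℂ, N = (1 : M2) ⊗ₖ W := by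
  have z01 : ∀ i j, N (0, i) (1, j) = 0 := by
    intro i j
    have := congrFun (congrFun h3 (0, i)) (1, j)
    simp [σm, Matrix.mul_apply, Fintype.sum_prod_type, Fin.sum_univ_two, Matrix.one_apply] at this
    fin_cases i <;> fin_cases j <;> simp at this ⊢ <;>
      first | exact self_eq_neg.1 this | exact self_eq_neg.1 this.symm
  have z10 : ∀ i j, N (1, i) (0, j) = 0 := by
    intro i j
    have := congrFun (congrFun h3 (1, i)) (0, j)
    simp [σm, Matrix.mul_apply, Fintype.sum_prod_type, Fin.sum_univ_two, Matrix.one_apply] at this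
    fin_cases i <;> fin_cases j <;> simp at this ⊢ <;>
      first | exact self_eq_neg.1 this | exact self_eq_neg.1 this.symm
  have z11 : ∀ i j, N (1, i) (1, j) = N (0, i) (0, j) := by
    intro i j
    have := congrFun (congrFun h1 (0, i)) (1, j)
    simp [σm, Matrix.mul_apply, Fintype.sum_prod_type, Fin.sum_univ_two, Matrix.one_apply] at this
    fin_cases i <;> fin_cases j <;> simp at this ⊢ <;>
      first | exact this | exact this.symm
  have hNW : N = (1 : M2) ⊗ₖ (Matrix.of fun i j => N (0, i) (0, j)) := by
    ext ⟨a, i⟩ ⟨b, j⟩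
    fin_cases a <;> fin_cases b <;> simp [z01, z10, z11]
  refine ⟨_, ?_, hNW⟩
  set W : M2 := Matrix.of fun i j => N (0, i) (0, j)
  rw [hNW, uni_iff] at hN
  simp only [conjTranspose_kronecker, ← mul_kronecker_mul, conjTranspose_one, mul_one] at hN
  rw [uni_iff]
  constructor
  · ext i j
    have := congrFun (congrFun hN.1 (0, i)) (0, j)
    simpa [Matrix.one_apply] using this
  · ext i j
    have := congrFun (congrFun hN.2 (0, i)) (0, j)
    simpa [Matrix.one_apply] using this

/-- σ_m on the first qubit controlled by the second. -/
def ctl (m : Fin 4) : M4 := (1 : M2) ⊗ₖ !![1, 0; 0, 0] + σm m ⊗ₖ !![0, 0; 0, 1]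

lemma sigma_herm (j : Fin 4) : (σm j)ᴴ = σm j := by
  fin_cases j <;> ext a b <;> fin_cases a <;> fin_cases b <;> simp [σm]

lemma sigma_sq (j : Fin 4) : σm j * σm j = 1 := by
  have := (uni_iff.1 (sigma_uni j)).1
  rwa [sigma_herm] at this

lemma ctl_herm (m : Fin 4) : (ctl m)ᴴ = ctl m := by
  have h0 : (!![1, 0; 0, 0] : M2)ᴴ = !![1, 0; 0, 0] := by
    ext a b; fin_cases a <;> fin_cases b <;> simp
  have h1 : (!![0, 0; 0, 1] : M2)ᴴ = !![0, 0; 0, 1] := by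
    ext a b; fin_cases a <;> fin_cases b <;> simp
  rw [ctl, conjTranspose_add, conjTranspose_kronecker, conjTranspose_kronecker, sigma_herm,
    conjTranspose_one, h0, h1]

lemma ctl_sq (m : Fin 4) : ctl m * ctl m = 1 := by
  have h : (!![1, 0; 0, 0] : M2) + !![0, 0; 0, 1] = 1 := by
    ext a b; fin_cases a <;> fin_cases b <;> simp
  simp only [ctl, mul_add, add_mul, ← mul_kronecker_mul, sigma_sq, mul_one, one_mul]
  simp only [Matrix.mul_fin_two, mul_zero, mul_one, add_zero, zero_add]
  have h0 : (!![0, 0; 0, 0] : M2) = 0 := by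
    ext a b; fin_cases a <;> fin_cases b <;> simp
  simp only [h0, kronecker_zero, add_zero, zero_add]
  rw [← kronecker_add, h, one_kronecker_one]

lemma ctl_uni (m : Fin 4) : ctl m ∈ Matrix.unitaryGroup (Fin 2 × Fin 2) ℂ := by
  rw [uni_iff, ctl_herm]; exact ⟨ctl_sq m, ctl_sq m⟩

lemma ctl_comm {m j : Fin 4} (h : σm m * σm j = σm j * σm m) :
    ctl m * (σm j ⊗ₖ (1 : M2)) = (σm j ⊗ₖ (1 : M2)) * ctl m := by
  simp only [ctl, mul_add, add_mul, ← mul_kronecker_mul, h, mul_one, one_mul]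

lemma ctl_anti {m j : Fin 4} (h : σm m * σm j = -(σm j * σm m)) :
    ctl m * (σm j ⊗ₖ (1 : M2)) = (σm j ⊗ₖ σm 3) * ctl m := by
  have h0 : σm 3 * (!![1, 0; 0, 0] : M2) = !![1, 0; 0, 0] := by
    ext a b; fin_cases a <;> fin_cases b <;> simp [σm]
  have h1 : σm 3 * (!![0, 0; 0, 1] : M2) = -!![0, 0; 0, 1] := by
    ext a b; fin_cases a <;> fin_cases b <;> simp [σm]
  simp only [ctl, mul_add, add_mul, ← mul_kronecker_mul, h, h0, h1, mul_one, one_mul]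
  congr 1
  ext ⟨a, i⟩ ⟨b, j⟩
  simp only [kroneckerMap_apply, Matrix.neg_apply, neg_mul, mul_neg]

lemma ctl_three (m : Fin 4) :
    ctl m * ((1 : M2) ⊗ₖ σm 3) = ((1 : M2) ⊗ₖ σm 3) * ctl m := by
  have h0 : σm 3 * (!![1, 0; 0, 0] : M2) = !![1, 0; 0, 0] * σm 3 := by
    ext a b; fin_cases a <;> fin_cases b <;> simp [σm]
  have h1 : σm 3 * (!![0, 0; 0, 1] : M2) = !![0, 0; 0, 1] * σm 3 := by
    ext a b; fin_cases a <;> fin_cases b <;> simp [σm]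
  simp only [ctl, mul_add, add_mul, ← mul_kronecker_mul, h0, h1, mul_one, one_mul]

lemma ctl_one (m : Fin 4) :
    ctl m * ((1 : M2) ⊗ₖ σm 1) = (σm m ⊗ₖ σm 1) * ctl m := by
  have h0 : σm 1 * (!![1, 0; 0, 0] : M2) = !![0, 0; 0, 1] * σm 1 := by
    ext a b; fin_cases a <;> fin_cases b <;> simp [σm]
  have h1 : σm 1 * (!![0, 0; 0, 1] : M2) = !![1, 0; 0, 0] * σm 1 := by
    ext a b; fin_cases a <;> fin_cases b <;> simp [σm]
  simp only [ctl, mul_add, add_mul, ← mul_kronecker_mul, h0, h1, mul_one, one_mul, sigma_sq]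
  rw [add_comm]

lemma sigma_mul (j k : Fin 4) : ∃ (l : Fin 4) (c : ℂ), (c = 1 ∨ c = -1 ∨ c = I ∨ c = -I) ∧
    σm j * σm k = c • σm l := by
  have t : ∀ (l : Fin 4) (c : ℂ), (c = 1 ∨ c = -1 ∨ c = I ∨ c = -I) → σm j * σm k = c • σm l →
    ∃ (l : Fin 4) (c : ℂ), (c = 1 ∨ c = -1 ∨ c = I ∨ c = -I) ∧ σm j * σm k = c • σm l :=
    fun l c h h' => ⟨l, c, h, h'⟩
  by_cases hj : j = 0
  · subst hj; exact t k 1 (by simp) (by simp [σm])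
  by_cases hk : k = 0
  · subst hk; exact t j 1 (by simp) (by simp [σm])
  by_cases hjk : j = k
  · subst hjk; exact t 0 1 (by simp) (by rw [sigma_sq]; simp [σm])
  fin_cases j <;> fin_cases k <;> simp at hj hk hjk
  · exact t 3 I (by simp) (by ext a b; fin_cases a <;> fin_cases b <;> simp [σm])
  · exact t 2 (-I) (by simp) (by ext a b; fin_cases a <;> fin_cases b <;> simp [σm])
  · exact t 3 (-I) (by simp) (by ext a b; fin_cases a <;> fin_cases b <;> simp [σm])
  · exact t 1 I (by simp) (by ext a b; fin_cases a <;> fin_cases b <;> simp [σm])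
  · exact t 2 I (by simp) (by ext a b; fin_cases a <;> fin_cases b <;> simp [σm])
  · exact t 1 (-I) (by simp) (by ext a b; fin_cases a <;> fin_cases b <;> simp [σm])

lemma phase_mul {c d : ℂ} (hc : c = 1 ∨ c = -1 ∨ c = I ∨ c = -I)
    (hd : d = 1 ∨ d = -1 ∨ d = I ∨ d = -I) :
    c * d = 1 ∨ c * d = -1 ∨ c * d = I ∨ c * d = -I := by
  rcases hc with rfl | rfl | rfl | rfl <;> rcases hd with rfl | rfl | rfl | rfl <;> simp

lemma P_smul {c : ℂ} (hc : c = 1 ∨ c = -1 ∨ c = I ∨ c = -I) {g : M4} (hg : g ∈ P₂) :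
    c • g ∈ P₂ := by
  obtain ⟨j, k, d, hd, rfl⟩ := hg
  exact ⟨j, k, c * d, phase_mul hc hd, by rw [smul_smul]⟩

lemma P_mul {g h : M4} (hg : g ∈ P₂) (hh : h ∈ P₂) : g * h ∈ P₂ := by
  obtain ⟨j, k, c, hc, rfl⟩ := hg
  obtain ⟨j', k', c', hc', rfl⟩ := hh
  obtain ⟨l, d, hd, h1⟩ := sigma_mul j j'
  obtain ⟨l', d', hd', h2⟩ := sigma_mul k k'
  rw [smul_mul_smul_comm, ← mul_kronecker_mul, h1, h2, smul_kronecker, kronecker_smul]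
  exact P_smul (phase_mul hc hc') (P_smul hd (P_smul hd' ⟨l, l', 1, by simp, by simp⟩))

lemma P_basic (j k : Fin 4) : σm j ⊗ₖ σm k ∈ P₂ := ⟨j, k, 1, by simp, by simp⟩

lemma sigma_zero : σm 0 = 1 := by simp [σm]

lemma sigma_comm_anti (m j : Fin 4) :
    σm m * σm j = σm j * σm m ∨ σm m * σm j = -(σm j * σm m) := by
  by_cases h : m = 0 ∨ j = 0 ∨ m = j
  · left
    rcases h with rfl | rfl | rfl <;> simp [sigma_zero]
  · right
    fin_cases m <;> fin_cases j <;> simp at h <;> ext a b <;> fin_cases a <;> fin_cases b <;>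
      simp [σm]

lemma ctl_clifford (m : Fin 4) : ctl m ∈ C₂ := by
  refine ⟨ctl_uni m, ?_⟩
  have hmul : ∀ g h, ctl m * g * (ctl m)ᴴ ∈ P₂ → ctl m * h * (ctl m)ᴴ ∈ P₂ →
      ctl m * (g * h) * (ctl m)ᴴ ∈ P₂ := by
    intro g h hg hh
    rw [← uconj_mul (ctl_uni m)]; exact P_mul hg hh
  have tr : ∀ {g g' : M4}, ctl m * g = g' * ctl m → g' ∈ P₂ → ctl m * g * (ctl m)ᴴ ∈ P₂ := by
    intro g g' h hg
    rw [h, mul_assoc, (uni_iff.1 (ctl_uni m)).2, mul_one]; exact hg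
  have hl : ∀ j, ctl m * (σm j ⊗ₖ (1 : M2)) * (ctl m)ᴴ ∈ P₂ := by
    intro j
    rcases sigma_comm_anti m j with h | h
    · exact tr (ctl_comm h) (by rw [← sigma_zero]; exact P_basic _ _)
    · exact tr (ctl_anti h) (P_basic _ _)
  have h1 : ctl m * ((1 : M2) ⊗ₖ σm 1) * (ctl m)ᴴ ∈ P₂ := tr (ctl_one m) (P_basic _ _)
  have h3 : ctl m * ((1 : M2) ⊗ₖ σm 3) * (ctl m)ᴴ ∈ P₂ :=
    tr (ctl_three m) (by rw [← sigma_zero]; exact P_basic _ _)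
  have hr : ∀ k, ctl m * ((1 : M2) ⊗ₖ σm k) * (ctl m)ᴴ ∈ P₂ := by
    intro k
    fin_cases k
    · have := hl 0
      simpa [sigma_zero] using this
    · exact h1
    · have e : (1 : M2) ⊗ₖ σm 2 = I • (((1 : M2) ⊗ₖ σm 1) * ((1 : M2) ⊗ₖ σm 3)) := by
        rw [← mul_kronecker_mul, ← kronecker_smul, mul_one]
        congr 1
        ext a b; fin_cases a <;> fin_cases b <;> simp [σm]
      show ctl m * ((1 : M2) ⊗ₖ σm 2) * (ctl m)ᴴ ∈ P₂
      rw [e, mul_smul_comm, smul_mul_assoc]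
      exact P_smul (by simp) (hmul _ _ h1 h3)
    · exact h3
  rintro g ⟨j, k, c, hc, rfl⟩
  have e : σm j ⊗ₖ σm k = (σm j ⊗ₖ (1 : M2)) * ((1 : M2) ⊗ₖ σm k) := by
    rw [← mul_kronecker_mul, mul_one, one_mul]
  rw [mul_smul_comm, smul_mul_assoc, e]
  exact P_smul hc (hmul _ _ (hl j) (hr k))

/-- Choice of the controlled Pauli. -/
lemma ctl_choice {w3 w1 : M2} (h3 : w3 = 1 ∨ w3 = σm 3) (h1 : w1 = 1 ∨ w1 = σm 3) :
    ∃ m, ctl m * (σm 3 ⊗ₖ (1 : M2)) = (σm 3 ⊗ₖ w3) * ctl m ∧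
      ctl m * (σm 1 ⊗ₖ (1 : M2)) = (σm 1 ⊗ₖ w1) * ctl m := by
  have a13 : σm 1 * σm 3 = -(σm 3 * σm 1) := by
    ext a b; fin_cases a <;> fin_cases b <;> simp [σm]
  have a31 : σm 3 * σm 1 = -(σm 1 * σm 3) := by rw [a13, neg_neg]
  have a23 : σm 2 * σm 3 = -(σm 3 * σm 2) := by
    ext a b; fin_cases a <;> fin_cases b <;> simp [σm]
  have a21 : σm 2 * σm 1 = -(σm 1 * σm 2) := by
    ext a b; fin_cases a <;> fin_cases b <;> simp [σm]
  rcases h3 with rfl | rfl <;> rcases h1 with rfl | rfl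
  · exact ⟨0, ctl_comm (by simp [sigma_zero]), ctl_comm (by simp [sigma_zero])⟩
  · exact ⟨3, ctl_comm rfl, ctl_anti a31⟩
  · exact ⟨1, ctl_anti a13, ctl_comm rfl⟩
  · exact ⟨2, ctl_anti a23, ctl_anti a21⟩

lemma main_case {U : M4} (hU : U ∈ Matrix.unitaryGroup (Fin 2 × Fin 2) ℂ) {T3 T1 V3 V1 : M2}
    (hT3 : T3 ∈ Matrix.unitaryGroup (Fin 2) ℂ) (hT1 : T1 ∈ Matrix.unitaryGroup (Fin 2) ℂ)
    (hV3 : V3 ∈ Matrix.unitaryGroup (Fin 2) ℂ) (hV1 : V1 ∈ Matrix.unitaryGroup (Fin 2) ℂ)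
    (sT3 : T3 * T3 = 1) (sT1 : T1 * T1 = 1) (sV3 : V3 * V3 = 1) (sV1 : V1 * V1 = 1)
    (hT : T3 * T1 = -(T1 * T3)) (hV : V3 * V1 = V1 * V3)
    (h3 : U * (σm 3 ⊗ₖ (1 : M2)) * Uᴴ = T3 ⊗ₖ V3)
    (h1 : U * (σm 1 ⊗ₖ (1 : M2)) * Uᴴ = T1 ⊗ₖ V1) :
    ∃ R ∈ Matrix.unitaryGroup (Fin 2) ℂ, ∃ S ∈ Matrix.unitaryGroup (Fin 2) ℂ,
    ∃ W ∈ Matrix.unitaryGroup (Fin 2) ℂ, (R ⊗ₖ S) * U * ((1 : M2) ⊗ₖ W) ∈ C₂ := by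
  obtain ⟨S, hS, ⟨e3, w3, he3, hw3, hS3⟩, ⟨e1, w1, he1, hw1, hS1⟩⟩ :=
    comm_pair hV3 hV1 sV3 sV1 hV
  have see : ∀ {e : ℂ}, (e = 1 ∨ e = -1) → star e * e = 1 ∧ e * e = 1 := by
    rintro e (rfl | rfl) <;> simp
  obtain ⟨R, hR, hR3, hR1⟩ := anti_pair (A := e3 • T3) (B := e1 • T1)
    (uni_smul hT3 (see he3).1) (uni_smul hT1 (see he1).1)
    (by rw [smul_mul_smul_comm, (see he3).2, sT3, one_smul])
    (by rw [smul_mul_smul_comm, (see he1).2, sT1, one_smul])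
    (by rw [smul_mul_smul_comm, smul_mul_smul_comm, hT, smul_neg, mul_comm e3])
  obtain ⟨m, hm3, hm1⟩ := ctl_choice hw3 hw1
  have hC : (R ⊗ₖ S) * U ∈ Matrix.unitaryGroup (Fin 2 × Fin 2) ℂ := mul_mem (uni_kron hR hS) hU
  have key : ∀ {s T V w : M2} {e : ℂ}, U * (s ⊗ₖ (1 : M2)) * Uᴴ = T ⊗ₖ V →
      S * V * Sᴴ = e • w → R * (e • T) * Rᴴ = s →
      ctl m * (s ⊗ₖ (1 : M2)) = (s ⊗ₖ w) * ctl m →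
      ((ctl m)ᴴ * ((R ⊗ₖ S) * U)) * (s ⊗ₖ (1 : M2)) =
        (s ⊗ₖ (1 : M2)) * ((ctl m)ᴴ * ((R ⊗ₖ S) * U)) := by
    intro s T V w e hU' hSV hRT hm
    have a1 : U * (s ⊗ₖ (1 : M2)) = (T ⊗ₖ V) * U := by
      rw [← hU', mul_assoc, (uni_iff.1 hU).1, mul_one]
    have hR' : e • (R * T) = s * R := by
      rw [← hRT, mul_assoc, (uni_iff.1 hR).1]; simp
    have hS' : S * V = e • (w * S) := by
      rw [← smul_mul_assoc, ← hSV, mul_assoc, (uni_iff.1 hS).1]; simp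
    have a2 : (R ⊗ₖ S) * (T ⊗ₖ V) = (s ⊗ₖ w) * (R ⊗ₖ S) := by
      rw [← mul_kronecker_mul, ← mul_kronecker_mul, hS', ← hR', smul_kronecker, kronecker_smul]
    have a3 : (ctl m)ᴴ * (s ⊗ₖ w) = (s ⊗ₖ (1 : M2)) * (ctl m)ᴴ := by
      rw [ctl_herm]
      calc ctl m * (s ⊗ₖ w) = ctl m * ((s ⊗ₖ w) * ctl m) * ctl m := by
            simp only [mul_assoc, ctl_sq, mul_one]
        _ = (ctl m * ctl m) * (s ⊗ₖ (1 : M2)) * ctl m := by rw [← hm]; simp only [mul_assoc]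
        _ = _ := by rw [ctl_sq, one_mul]
    calc _ = (ctl m)ᴴ * ((R ⊗ₖ S) * (U * (s ⊗ₖ (1 : M2)))) := by simp only [mul_assoc]
      _ = (ctl m)ᴴ * (((R ⊗ₖ S) * (T ⊗ₖ V)) * U) := by rw [a1]; simp only [mul_assoc]
      _ = ((ctl m)ᴴ * (s ⊗ₖ w)) * ((R ⊗ₖ S) * U) := by rw [a2]; simp only [mul_assoc]
      _ = _ := by rw [a3]; simp only [mul_assoc]
  obtain ⟨W, hW, hNW⟩ := commutant (mul_mem (uni_conj (ctl_uni m)) hC)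
    (key h3 hS3 hR3 hm3) (key h1 hS1 hR1 hm1)
  refine ⟨R, hR, S, hS, Wᴴ, uni_conj hW, ?_⟩
  have : (R ⊗ₖ S) * U = ctl m * ((1 : M2) ⊗ₖ W) := by
    rw [← hNW, ← mul_assoc, (uni_iff.1 (ctl_uni m)).2, one_mul]
  rw [this, mul_assoc, ← mul_kronecker_mul, (uni_iff.1 hW).2, mul_one, one_kronecker_one, mul_one]
  exact ctl_clifford m

/-- The swap gate. -/
def swp : M4 := (1 : M4).submatrix Prod.swap id

lemma swp_mul (X : M4) : swp * X = X.submatrix Prod.swap id := by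
  ext ⟨a, b⟩ ⟨c, d⟩
  simp [swp, Matrix.mul_apply, Matrix.one_apply]

lemma swp_herm : swpᴴ = swp := by
  ext ⟨a, b⟩ ⟨c, d⟩
  simp only [swp, conjTranspose_apply, submatrix_apply, Matrix.one_apply, Prod.swap_prod_mk, id]
  fin_cases a <;> fin_cases b <;> fin_cases c <;> fin_cases d <;> simp

lemma swp_sq : swp * swp = 1 := by
  rw [swp_mul, swp]; ext ⟨a, b⟩ ⟨c, d⟩
  rfl

lemma swp_uni : swp ∈ Matrix.unitaryGroup (Fin 2 × Fin 2) ℂ := by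
  rw [uni_iff, swp_herm]; exact ⟨swp_sq, swp_sq⟩

lemma swp_kron (A B : M2) : swp * (A ⊗ₖ B) = (B ⊗ₖ A) * swp := by
  have : (B ⊗ₖ A) * swp = (swp * (B ⊗ₖ A)ᴴ)ᴴ := by
    rw [conjTranspose_mul, conjTranspose_conjTranspose, swp_herm]
  rw [this, swp_mul, swp_mul]
  ext ⟨a, b⟩ ⟨c, d⟩
  simp [mul_comm]

lemma swp_clifford {C : M4} (hC : C ∈ C₂) : swp * C ∈ C₂ := by
  refine ⟨mul_mem swp_uni hC.1, ?_⟩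
  intro g hg
  obtain ⟨j, k, c, hc, h⟩ := hC.2 g hg
  have : swp * C * g * (swp * C)ᴴ = swp * (C * g * Cᴴ) * swp := by
    rw [conjTranspose_mul, swp_herm]; simp only [mul_assoc]
  rw [this, h, mul_smul_comm, smul_mul_assoc, swp_kron, mul_assoc, swp_sq, mul_one]
  exact ⟨k, j, c, hc, rfl⟩

/-- Anticommutation of products of involutions. -/
lemma split_anti {T3 T1 V3 V1 : M2}
    (sT3 : T3 * T3 = 1) (sT1 : T1 * T1 = 1) (sV3 : V3 * V3 = 1) (sV1 : V1 * V1 = 1)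
    (h : (T3 ⊗ₖ V3) * (T1 ⊗ₖ V1) = -((T1 ⊗ₖ V1) * (T3 ⊗ₖ V3))) :
    (T3 * T1 = -(T1 * T3) ∧ V3 * V1 = V1 * V3) ∨
    (T3 * T1 = T1 * T3 ∧ V3 * V1 = -(V1 * V3)) := by
  have h' : ((T3 * T1) * (T3 * T1)) ⊗ₖ ((V3 * V1) * (V3 * V1)) = (-1 : ℂ) • (1 : M4) := by
    rw [mul_kronecker_mul, mul_kronecker_mul]
    nth_rewrite 1 [h]
    rw [neg_mul, ← mul_kronecker_mul, ← mul_kronecker_mul, ← mul_kronecker_mul]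
    have q : ∀ {A B : M2}, A * A = 1 → B * B = 1 → B * A * (A * B) = 1 := by
      intro A B hA hB
      rw [mul_assoc, ← mul_assoc A, hA, one_mul, hB]
    rw [q sT3 sT1, q sV3 sV1, one_kronecker_one]; simp
  obtain ⟨a, b, ha, hb, hab⟩ := kron_scalar (by norm_num) h'
  have q2 : ∀ {A B : M2} {c : ℂ}, A * A = 1 → B * B = 1 → (A * B) * (A * B) = c • 1 →
      A * B = c • (B * A) := by
    intro A B c hA hB hc
    calc A * B = (A * B) * (A * B) * (B * A) := by
          have : A * B * (B * A) = 1 := by rw [mul_assoc, ← mul_assoc B, hB, one_mul, hA]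
          rw [mul_assoc (A * B), this, mul_one]
      _ = _ := by rw [hc, smul_mul_assoc, one_mul]
  have r1 := q2 sT3 sT1 ha
  have r2 := q2 sV3 sV1 hb
  have ha2 : a * a = 1 := by
    have e : T3 * T1 = (a * a) • (T3 * T1) := by
      have : T1 * T3 = a • (T3 * T1) := by
        calc T1 * T3 = T3 * (T3 * T1) * T3 := by rw [← mul_assoc, sT3, one_mul]
          _ = a • (T3 * T1) := by
            conv_lhs =>
              rw [r1, mul_smul_comm, smul_mul_assoc, mul_assoc, mul_assoc, sT3, mul_one]
      rw [← smul_smul, ← this]; exact r1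
    have e2 : (1 : M2) = (a * a) • 1 := by
      have := congrArg (· * (T1 * T3)) e
      simp only [smul_mul_assoc] at this
      have q : T3 * T1 * (T1 * T3) = 1 := by rw [mul_assoc, ← mul_assoc T1, sT1, one_mul, sT3]
      rwa [q] at this
    have := congrFun (congrFun e2 0) 0
    simpa using this.symm
  rcases mul_self_eq_one_iff.1 ha2 with rfl | rfl
  · right
    rw [one_mul] at hab; subst hab
    exact ⟨by simpa using r1, by simpa using r2⟩
  · left
    have : b = 1 := by linear_combination -hab
    subst this
    exact ⟨by simpa using r1, by simpa using r2⟩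

/-- Lemma 1 of the paper: U ∈ L iff U is locally (unitarily) equivalent to a two-qubit
Clifford operator. -/
theorem lfam_iff_locally_clifford (U : Matrix (Fin 2 × Fin 2) (Fin 2 × Fin 2) ℂ)
    (hU : U ∈ Matrix.unitaryGroup (Fin 2 × Fin 2) ℂ) :
    U ∈ Lfam ↔
      ∃ R₁ ∈ Matrix.unitaryGroup (Fin 2) ℂ, ∃ S₁ ∈ Matrix.unitaryGroup (Fin 2) ℂ,
      ∃ R₂ ∈ Matrix.unitaryGroup (Fin 2) ℂ, ∃ S₂ ∈ Matrix.unitaryGroup (Fin 2) ℂ,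
        (R₁ ⊗ₖ S₁) * U * (R₂ ⊗ₖ S₂) ∈ C₂ := by
  constructor
  · rintro ⟨-, R, hR, hL⟩
    set X : M4 := U * (R ⊗ₖ (1 : M2)) with hX
    have hXu : X ∈ Matrix.unitaryGroup (Fin 2 × Fin 2) ℂ := mul_mem hU (uni_kron hR (one_mem _))
    have hXs : ∀ s : M2, X * (s ⊗ₖ (1 : M2)) * Xᴴ = U * ((R * s * Rᴴ) ⊗ₖ (1 : M2)) * Uᴴ := by
      intro s
      have : (R * s * Rᴴ) ⊗ₖ (1 : M2) =
          (R ⊗ₖ (1 : M2)) * (s ⊗ₖ (1 : M2)) * (R ⊗ₖ (1 : M2))ᴴ := by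
        rw [conjTranspose_kronecker, ← mul_kronecker_mul, ← mul_kronecker_mul]; simp
      rw [this, hX, conjTranspose_mul]; simp only [mul_assoc]
    have ex : ∀ j : Fin 4, j ≠ 0 → ∃ T ∈ Matrix.unitaryGroup (Fin 2) ℂ,
        ∃ V ∈ Matrix.unitaryGroup (Fin 2) ℂ, T * T = 1 ∧ V * V = 1 ∧
        X * (σm j ⊗ₖ (1 : M2)) * Xᴴ = T ⊗ₖ V := by
      intro j hj
      obtain ⟨T, hT, V, hV, h⟩ := hL j hj
      rw [← hXs] at h
      obtain ⟨T', hT', V', hV', h1, h2, h3⟩ := normalise hT hV (by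
        rw [← h, uconj_mul hXu, ← mul_kronecker_mul, sigma_sq, mul_one, one_kronecker_one, mul_one,
          (uni_iff.1 hXu).2])
      exact ⟨T', hT', V', hV', h1, h2, h.trans h3⟩
    obtain ⟨T3, hT3, V3, hV3, sT3, sV3, h3⟩ := ex 3 (by decide)
    obtain ⟨T1, hT1, V1, hV1, sT1, sV1, h1⟩ := ex 1 (by decide)
    have a31 : σm 3 * σm 1 = -(σm 1 * σm 3) := by
      ext a b; fin_cases a <;> fin_cases b <;> simp [σm]
    have ha : (T3 ⊗ₖ V3) * (T1 ⊗ₖ V1) = -((T1 ⊗ₖ V1) * (T3 ⊗ₖ V3)) := by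
      rw [← h3, ← h1, uconj_mul hXu, uconj_mul hXu, ← mul_kronecker_mul, ← mul_kronecker_mul, a31,
        ← neg_one_smul ℂ (σm 1 * σm 3), smul_kronecker]
      simp
    have fin2 : ∀ W : M2, (R ⊗ₖ (1 : M2)) * ((1 : M2) ⊗ₖ W) = R ⊗ₖ W := by
      intro W; rw [← mul_kronecker_mul, mul_one, one_mul]
    rcases split_anti sT3 sT1 sV3 sV1 ha with ⟨hT, hV⟩ | ⟨hT, hV⟩
    · obtain ⟨R₁, hR₁, S₁, hS₁, W, hW, h⟩ :=
        main_case hXu hT3 hT1 hV3 hV1 sT3 sT1 sV3 sV1 hT hV h3 h1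
      refine ⟨R₁, hR₁, S₁, hS₁, R, hR, W, hW, ?_⟩
      rw [← fin2]
      simpa only [hX, mul_assoc] using h
    · have sw : ∀ {s T V : M2}, X * (s ⊗ₖ (1 : M2)) * Xᴴ = T ⊗ₖ V →
          (swp * X) * (s ⊗ₖ (1 : M2)) * (swp * X)ᴴ = V ⊗ₖ T := by
        intro s T V h
        have : (swp * X) * (s ⊗ₖ (1 : M2)) * (swp * X)ᴴ
            = swp * (X * (s ⊗ₖ (1 : M2)) * Xᴴ) * swp := by
          rw [conjTranspose_mul, swp_herm]; simp only [mul_assoc]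
        rw [this, h, swp_kron, mul_assoc, swp_sq, mul_one]
      obtain ⟨R₁, hR₁, S₁, hS₁, W, hW, h⟩ :=
        main_case (mul_mem swp_uni hXu) hV3 hV1 hT3 hT1 sV3 sV1 sT3 sT1 hV hT (sw h3) (sw h1)
      refine ⟨S₁, hS₁, R₁, hR₁, R, hR, W, hW, ?_⟩
      have h' := swp_clifford h
      have e : swp * ((R₁ ⊗ₖ S₁) * (swp * X) * ((1 : M2) ⊗ₖ W))
          = (S₁ ⊗ₖ R₁) * U * (R ⊗ₖ W) := by
        calc _ = (swp * (R₁ ⊗ₖ S₁)) * swp * X * ((1 : M2) ⊗ₖ W) := by simp only [mul_assoc]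
          _ = (S₁ ⊗ₖ R₁) * X * ((1 : M2) ⊗ₖ W) := by
            rw [swp_kron, mul_assoc (S₁ ⊗ₖ R₁) swp, swp_sq, mul_one]
          _ = _ := by rw [← fin2]; simp only [hX, mul_assoc]
      rwa [e] at h'
  · rintro ⟨R₁, hR₁, S₁, hS₁, R₂, hR₂, S₂, hS₂, hC⟩
    refine ⟨hU, R₂, hR₂, fun j _ => ?_⟩
    obtain ⟨a, b, c, hc, h⟩ := hC.2 _ (P_basic j 0)
    have hcu : star c * c = 1 := by rcases hc with rfl | rfl | rfl | rfl <;> simp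
    refine ⟨c • (R₁ᴴ * σm a * R₁), uni_smul (mul_mem (mul_mem (uni_conj hR₁) (sigma_uni a)) hR₁) hcu,
      S₁ᴴ * σm b * S₁, mul_mem (mul_mem (uni_conj hS₁) (sigma_uni b)) hS₁, ?_⟩
    have e1 : (c • (R₁ᴴ * σm a * R₁)) ⊗ₖ (S₁ᴴ * σm b * S₁)
        = (R₁ ⊗ₖ S₁)ᴴ * (c • (σm a ⊗ₖ σm b)) * (R₁ ⊗ₖ S₁) := by
      rw [conjTranspose_kronecker, mul_smul_comm, smul_mul_assoc, ← mul_kronecker_mul,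
        ← mul_kronecker_mul, smul_kronecker]
    have e2 : (R₂ * σm j * R₂ᴴ) ⊗ₖ (1 : M2)
        = (R₂ ⊗ₖ S₂) * (σm j ⊗ₖ σm 0) * (R₂ ⊗ₖ S₂)ᴴ := by
      rw [conjTranspose_kronecker, ← mul_kronecker_mul, ← mul_kronecker_mul, sigma_zero, mul_one,
        (uni_iff.1 hS₂).2]
    have hK := (uni_iff.1 (uni_kron hR₁ hS₁)).1
    rw [e1, ← h, e2, conjTranspose_mul, conjTranspose_mul]
    set K := R₁ ⊗ₖ S₁
    set G := R₂ ⊗ₖ S₂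
    calc _ = 1 * U * (G * (σm j ⊗ₖ σm 0) * Gᴴ) * Uᴴ * 1 := by rw [one_mul, mul_one]
      _ = _ := by rw [← hK]; simp only [mul_assoc]

end
end

section
/- Every two-qubit unitary U ∈ U(4) can be decomposed as U = (R₁⊗S₁) Ω (R₂⊗S₂), where R₁, S₁, R₂, S₂ ∈ U(2) are single-qubit unitaries and Ω is a unitary diagonal in the magic basis, i.e., Ω = Σ_{k=0}^{3} e^{iφ_k}|Φ_k⟩⟨Φ_k| for some real φ₀,…,φ₃. -/
open Matrix Complex
open scoped Matrix Kronecker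

noncomputable section

def ketv (i j : Fin 2) : Fin 2 × Fin 2 → ℂ := fun x => if x = (i, j) then 1 else 0

/-- The magic basis of ℂ²⊗ℂ². -/
def magic : Fin 4 → (Fin 2 × Fin 2 → ℂ) :=
  ![(Real.sqrt 2 : ℂ)⁻¹ • (ketv 0 0 + ketv 1 1),
    (-I) • ((Real.sqrt 2 : ℂ)⁻¹ • (ketv 0 0 - ketv 1 1)),
    (-I) • ((Real.sqrt 2 : ℂ)⁻¹ • (ketv 0 1 + ketv 1 0)),
    (Real.sqrt 2 : ℂ)⁻¹ • (ketv 0 1 - ketv 1 0)]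

/-- Σ_k e^{iφ_k}|Φ_k⟩⟨Φ_k| : the operator diagonal in the magic basis with
eigenphases φ₀,…,φ₃. -/
def magicDiag (φ : Fin 4 → ℝ) : Matrix (Fin 2 × Fin 2) (Fin 2 × Fin 2) ℂ :=
  ∑ k, Complex.exp (I * φ k) • Matrix.vecMulVec (magic k) (star (magic k))


/-- the 2x2 matrix form (times sqrt 2) of a real combination of magic basis vectors -/
def qm (x : Fin 4 → ℝ) : Matrix (Fin 2) (Fin 2) ℂ :=
  !![x 0 - I * x 1, x 3 - I * x 2; -x 3 - I * x 2, x 0 + I * x 1]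

abbrev Eu := EuclideanSpace ℝ (Fin 4)

lemma qm_refl (v x : Eu) (hv : v ≠ 0) :
    qm ((ℝ ∙ v)ᗮ.reflection x) =
      -(((‖v‖⁻¹ : ℝ) : ℂ) • qm v) * (qm x)ᴴ * (((‖v‖⁻¹ : ℝ) : ℂ) • qm v) := by
  have hn : ‖v‖ ^ 2 = v 0 ^ 2 + v 1 ^ 2 + v 2 ^ 2 + v 3 ^ 2 := by
    rw [EuclideanSpace.real_norm_sq_eq, Fin.sum_univ_four]
  have h0 : ‖v‖ ≠ 0 := norm_ne_zero_iff.mpr hv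
  have hx : ∀ i, (ℝ ∙ v)ᗮ.reflection x i =
      x i - 2 * (v 0 * x 0 + v 1 * x 1 + v 2 * x 2 + v 3 * x 3) * (‖v‖⁻¹) ^ 2 * v i := by
    intro i
    rw [Submodule.reflection_orthogonal_apply, Submodule.reflection_singleton_apply]
    simp [PiLp.inner_apply, Fin.sum_univ_four]
    ring
  have hc : ((‖v‖⁻¹ : ℝ) : ℂ) ^ 2 * (v 0 ^ 2 + v 1 ^ 2 + v 2 ^ 2 + v 3 ^ 2) = 1 := by
    have : (‖v‖⁻¹) ^ 2 * (v 0 ^ 2 + v 1 ^ 2 + v 2 ^ 2 + v 3 ^ 2) = 1 := by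
      rw [← hn]; field_simp
    exact_mod_cast this
  have hI : I ^ 2 = -1 := I_sq
  unfold qm
  simp only [hx]
  generalize ‖v‖⁻¹ = N at *
  ext i j
  fin_cases i <;> fin_cases j <;>
    simp [Matrix.mul_apply, Fin.sum_univ_two, Matrix.vecMul, dotProduct, -Matrix.cons_vecMul]
  all_goals clear hx hn h0
  all_goals grind

lemma qm_unit (v : Eu) (hv : v ≠ 0) :
    (((‖v‖⁻¹ : ℝ) : ℂ) • qm v) ∈ Matrix.unitaryGroup (Fin 2) ℂ := by
  have hn : ‖v‖ ^ 2 = v 0 ^ 2 + v 1 ^ 2 + v 2 ^ 2 + v 3 ^ 2 := by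
    rw [EuclideanSpace.real_norm_sq_eq, Fin.sum_univ_four]
  have h0 : ‖v‖ ≠ 0 := norm_ne_zero_iff.mpr hv
  have hc : ((‖v‖⁻¹ : ℝ) : ℂ) ^ 2 * (v 0 ^ 2 + v 1 ^ 2 + v 2 ^ 2 + v 3 ^ 2) = 1 := by
    have : (‖v‖⁻¹) ^ 2 * (v 0 ^ 2 + v 1 ^ 2 + v 2 ^ 2 + v 3 ^ 2) = 1 := by
      rw [← hn]; field_simp
    exact_mod_cast this
  have hI : I ^ 2 = -1 := I_sq
  rw [Matrix.mem_unitaryGroup_iff, star_eq_conjTranspose]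
  unfold qm
  generalize ‖v‖⁻¹ = N at *
  ext i j
  fin_cases i <;> fin_cases j <;>
    simp [Matrix.mul_apply, Fin.sum_univ_two]
  all_goals clear hn h0
  all_goals grind

lemma isom_qm (l : List Eu) :
    ∃ A ∈ Matrix.unitaryGroup (Fin 2) ℂ, ∃ B ∈ Matrix.unitaryGroup (Fin 2) ℂ,
      (∀ x : Eu, qm ((l.map fun v => (ℝ ∙ v)ᗮ.reflection).prod x) = A * qm x * B) ∨
      (∀ x : Eu, qm ((l.map fun v => (ℝ ∙ v)ᗮ.reflection).prod x) = A * (qm x)ᴴ * B) := by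
  induction l with
  | nil => exact ⟨1, one_mem _, 1, one_mem _, Or.inl fun x => by simp⟩
  | cons v l ih =>
    obtain ⟨A, hA, B, hB, h⟩ := ih
    by_cases hv : v = 0
    · refine ⟨A, hA, B, hB, ?_⟩
      subst hv
      have : ((0 : Eu) :: l |>.map fun v => (ℝ ∙ v)ᗮ.reflection).prod
          = (l.map fun v => (ℝ ∙ v)ᗮ.reflection).prod := by
        rw [List.map_cons, List.prod_cons]
        ext x : 1
        change (ℝ ∙ (0 : Eu))ᗮ.reflection _ = _
        rw [Submodule.reflection_orthogonal_apply, Submodule.reflection_singleton_apply]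
        simp
      rw [this]; exact h
    · have hu := qm_unit v hv
      have hr := fun x => qm_refl v x hv
      set u := (((‖v‖⁻¹ : ℝ) : ℂ) • qm v)
      have hun : -u ∈ Matrix.unitaryGroup (Fin 2) ℂ := by
        rw [Matrix.mem_unitaryGroup_iff] at hu ⊢
        simpa using hu
      refine ⟨-u * Bᴴ, mul_mem hun (Unitary.star_mem hB), Aᴴ * u,
        mul_mem (Unitary.star_mem hA) hu, ?_⟩
      rcases h with h | h
      · right
        intro x
        rw [List.map_cons, List.prod_cons, LinearIsometryEquiv.coe_mul, Function.comp_apply, hr, h]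
        simp [Matrix.conjTranspose_mul, Matrix.mul_assoc]
      · left
        intro x
        rw [List.map_cons, List.prod_cons, LinearIsometryEquiv.coe_mul, Function.comp_apply, hr, h]
        simp [Matrix.conjTranspose_mul, Matrix.mul_assoc]

/-- complexification -/
abbrev cx (O : Matrix (Fin 4) (Fin 4) ℝ) : Matrix (Fin 4) (Fin 4) ℂ := O.map Complex.ofReal

/-- columns are magic basis vectors -/
def MM : Matrix (Fin 2 × Fin 2) (Fin 4) ℂ := Matrix.of fun x k => magic k x

lemma sqrt2c : ((Real.sqrt 2 : ℝ) : ℂ)⁻¹ * ((Real.sqrt 2 : ℝ) : ℂ)⁻¹ = 2⁻¹ := by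
  rw [← mul_inv]
  congr 1
  exact_mod_cast Real.mul_self_sqrt (by norm_num : (0:ℝ) ≤ 2)

lemma MM_left : MMᴴ * MM = 1 := by
  ext i j
  have h := sqrt2c
  have hI : I ^ 2 = -1 := I_sq
  fin_cases i <;> fin_cases j <;>
    simp [Matrix.mul_apply, Fintype.sum_prod_type, MM, magic, ketv]
  all_goals generalize ((Real.sqrt 2 : ℝ) : ℂ)⁻¹ = s at *
  all_goals grind

lemma MM_right : MM * MMᴴ = 1 := by
  exact (Matrix.mul_eq_one_comm_of_card_eq _ _ _ (by simp)).mp MM_left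

lemma MM_mulVec (x : Fin 4 → ℝ) (p : Fin 2 × Fin 2) :
    (MM *ᵥ (fun k => (x k : ℂ))) p = ((Real.sqrt 2 : ℝ) : ℂ)⁻¹ * qm x p.1 p.2 := by
  obtain ⟨i, j⟩ := p
  fin_cases i <;> fin_cases j <;>
    simp [Matrix.mulVec, dotProduct, Fin.sum_univ_four, MM, magic, ketv, qm] <;> ring

lemma magicDiag_eq (φ : Fin 4 → ℝ) :
    magicDiag φ = MM * Matrix.diagonal (fun k => Complex.exp (I * φ k)) * MMᴴ := by
  ext i j
  rw [Matrix.mul_apply]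
  simp only [Matrix.mul_diagonal]
  simp [magicDiag, Matrix.sum_apply, MM, vecMulVec_apply]
  refine Finset.sum_congr rfl fun k _ => by ring

lemma so4 (O : Matrix (Fin 4) (Fin 4) ℝ) (hO : Oᵀ * O = 1) :
    ∃ s : Fin 4 → ℝ, (∀ k, s k * s k = 1) ∧
    ∃ R ∈ Matrix.unitaryGroup (Fin 2) ℂ, ∃ S ∈ Matrix.unitaryGroup (Fin 2) ℂ,
      MM * cx (O * diagonal s) * MMᴴ = R ⊗ₖ S := by
  have key : ∃ f : Eu ≃ₗᵢ[ℝ] Eu, ∀ x : Eu, ∀ i, f x i = (O *ᵥ x.ofLp) i := by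
    let g : Eu →ₗᵢ[ℝ] Eu := (Matrix.toEuclideanLin O).isometryOfInner (by
      intro x y
      simp only [EuclideanSpace.inner_eq_star_dotProduct, Matrix.ofLp_toLpLin,
        Matrix.toLin'_apply, star_trivial]
      rw [Matrix.dotProduct_mulVec, Matrix.vecMul_mulVec, hO]
      simp)
    exact ⟨g.toLinearIsometryEquiv rfl, fun x i => rfl⟩
  obtain ⟨f, hf⟩ := key
  obtain ⟨l, -, hl⟩ := f.reflections_generate_dim
  obtain ⟨A, hA, B, hB, h⟩ := isom_qm l
  rw [← hl] at h
  have hfq : ∀ x : Fin 4 → ℝ, qm (f (WithLp.toLp 2 x)) = qm (O *ᵥ x) := by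
    intro x
    congr 1
    ext i
    exact hf _ i
  have hBt : Bᵀ ∈ Matrix.unitaryGroup (Fin 2) ℂ := by
    rw [Matrix.mem_unitaryGroup_iff', star_eq_conjTranspose] at *
    have := congrArg Matrix.transpose (Matrix.mem_unitaryGroup_iff.mp (Matrix.mem_unitaryGroup_iff'.mpr hB))
    simpa [star_eq_conjTranspose, Matrix.transpose_mul, Matrix.conjTranspose, Matrix.transpose_map] using this
  -- sign vector
  obtain ⟨s, hs, h⟩ : ∃ s : Fin 4 → ℝ, (∀ k, s k * s k = 1) ∧
      ∀ x : Fin 4 → ℝ, qm ((O * diagonal s) *ᵥ x) = A * qm x * B := by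
    rcases h with h | h
    · refine ⟨fun _ => 1, by simp, fun x => ?_⟩
      rw [← Matrix.mulVec_mulVec, ← hfq, h]
      simp
    · refine ⟨![1, -1, -1, -1], by intro k; fin_cases k <;> simp, fun x => ?_⟩
      rw [← Matrix.mulVec_mulVec, ← hfq, h]
      congr 2
      ext i j
      fin_cases i <;> fin_cases j <;> simp [qm, Matrix.mulVec_diagonal] <;> ring
  refine ⟨s, hs, A, hA, Bᵀ, hBt, ?_⟩
  suffices hh : MM * cx (O * diagonal s) = (A ⊗ₖ Bᵀ) * MM by
    rw [hh, Matrix.mul_assoc, MM_right, Matrix.mul_one]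
  generalize O * diagonal s = P at *
  ext p k
  have h1 := MM_mulVec (P *ᵥ Pi.single k 1) p
  have h2 : (MM * cx P) p k = (MM *ᵥ (fun j => ((P *ᵥ Pi.single k 1) j : ℂ))) p := by
    rw [Matrix.mulVec_single_one]
    simp [Matrix.mul_apply, Matrix.mulVec, dotProduct]
  have h3 : ∀ p, MM p k = ((Real.sqrt 2 : ℝ) : ℂ)⁻¹ * qm (Pi.single k 1) p.1 p.2 := by
    intro p
    rw [← MM_mulVec]
    simp [Matrix.mulVec, dotProduct, Pi.single_apply, apply_ite]
  rw [h2, h1, h, Matrix.mul_apply]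
  simp only [h3, Fintype.sum_prod_type, Matrix.mul_apply, Fin.sum_univ_two,
    Matrix.kroneckerMap_apply, Matrix.transpose_apply]
  ring

lemma simdiag (A B : Matrix (Fin 4) (Fin 4) ℝ) (hA : Aᵀ = A) (hB : Bᵀ = B) (hAB : A * B = B * A) :
    ∃ O : Matrix (Fin 4) (Fin 4) ℝ, Oᵀ * O = 1 ∧ ∃ a b : Fin 4 → ℝ,
      A * O = O * diagonal a ∧ B * O = O * diagonal b := by
  have sA : (Matrix.toEuclideanLin A).IsSymmetric :=
    Matrix.isSymmetric_toEuclideanLin_iff.mpr (by simpa [Matrix.IsHermitian] using hA)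
  have sB : (Matrix.toEuclideanLin B).IsSymmetric :=
    Matrix.isSymmetric_toEuclideanLin_iff.mpr (by simpa [Matrix.IsHermitian] using hB)
  have hc : Commute (Matrix.toEuclideanLin A) (Matrix.toEuclideanLin B) := by
    refine LinearMap.ext fun x => ?_
    simp [Module.End.mul_apply, Matrix.toLpLin_apply, hAB]
  have hV := LinearMap.IsSymmetric.directSum_isInternal_of_commute sA sB hc
  have hV' := LinearMap.IsSymmetric.orthogonalFamily_eigenspace_inf_eigenspace sA sB
  set V : ℝ × ℝ → Submodule ℝ Eu := fun i => Module.End.eigenspace (Matrix.toEuclideanLin A) i.2 ⊓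
    Module.End.eigenspace (Matrix.toEuclideanLin B) i.1 with hVdef
  haveI : Fintype {i // V i ≠ ⊥} := hV.submodule_iSupIndep.fintypeNeBotOfFiniteDimensional
  have hW := (DirectSum.isInternal_ne_bot_iff (A := V)).mpr hV
  have hW' : OrthogonalFamily ℝ (fun i : {i // V i ≠ ⊥} => V i) fun i => (V i).subtypeₗᵢ :=
    hV'.comp Subtype.val_injective
  have hn : Module.finrank ℝ Eu = 4 := by simp
  obtain ⟨b, c, hb⟩ : ∃ (b : OrthonormalBasis (Fin 4) ℝ Eu) (c : Fin 4 → ℝ × ℝ),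
      ∀ k, b k ∈ V (c k) :=
    ⟨hW.subordinateOrthonormalBasis hn hW',
      fun k => (hW.subordinateOrthonormalBasisIndex hn k hW').1,
      fun k => hW.subordinateOrthonormalBasis_subordinate hn k hW'⟩
  refine ⟨Matrix.of fun i k => b k i, ?_, fun k => (c k).2, fun k => (c k).1, ?_, ?_⟩
  · ext i j
    have := b.inner_eq_ite i j
    rw [PiLp.inner_apply] at this
    simp only [Matrix.mul_apply, Matrix.transpose_apply, Matrix.of_apply, Matrix.one_apply]
    rw [← this]
    refine Finset.sum_congr rfl fun k _ => by simp [mul_comm]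
  · ext i k
    have h := Module.End.mem_eigenspace_iff.mp (Submodule.mem_inf.mp (hb k)).1
    have h' := congrArg (fun v : Eu => v i) h
    rw [Matrix.mul_diagonal]
    simpa [Matrix.mul_apply, Matrix.mulVec, dotProduct, mul_comm] using h'
  · ext i k
    have h := Module.End.mem_eigenspace_iff.mp (Submodule.mem_inf.mp (hb k)).2
    have h' := congrArg (fun v : Eu => v i) h
    rw [Matrix.mul_diagonal]
    simpa [Matrix.mul_apply, Matrix.mulVec, dotProduct, mul_comm] using h'

lemma decomp (V : Matrix (Fin 4) (Fin 4) ℂ) (hV : Vᴴ * V = 1) :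
    ∃ O₁ O₂ : Matrix (Fin 4) (Fin 4) ℝ, O₁ᵀ * O₁ = 1 ∧ O₂ᵀ * O₂ = 1 ∧
    ∃ d : Fin 4 → ℂ, (∀ k, ‖d k‖ = 1) ∧ V = cx O₁ * diagonal d * cx O₂ᵀ := by
  have hV2 : V * Vᴴ = 1 := mul_eq_one_comm.mp hV
  have hV3 : (Vᵀ)ᴴ * Vᵀ = 1 := by
    have := congrArg Matrix.transpose hV2
    rw [Matrix.transpose_mul, Matrix.transpose_one] at this
    exact this
  set W := Vᵀ * V with hWdef
  have hWs : Wᵀ = W := by simp [hWdef, Matrix.transpose_mul]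
  have hWu : Wᴴ * W = 1 := by
    calc Wᴴ * W = Vᴴ * ((Vᵀ)ᴴ * Vᵀ) * V := by
          simp only [hWdef, Matrix.conjTranspose_mul, Matrix.mul_assoc]
      _ = 1 := by rw [hV3, Matrix.mul_one, hV]
  have hWsij : ∀ i j, W i j = W j i := fun i j => congrFun (congrFun hWs j) i
  obtain ⟨O, hO, a, b, hAO, hBO⟩ := simdiag (W.map Complex.re) (W.map Complex.im)
    (by ext i j; simp [hWsij i j]) (by ext i j; simp [hWsij i j])
    (by
      ext i j
      have h := congrArg Complex.im (congrFun (congrFun hWu i) j)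
      have h1 : ((1 : Matrix (Fin 4) (Fin 4) ℂ) i j).im = 0 := by
        rw [Matrix.one_apply]; split_ifs <;> simp
      rw [h1, Matrix.mul_apply, Complex.im_sum] at h
      simp only [Matrix.mul_apply, Matrix.map_apply]
      rw [← sub_eq_zero, ← Finset.sum_sub_distrib, ← h]
      refine Finset.sum_congr rfl fun k _ => ?_
      rw [Matrix.conjTranspose_apply, hWsij k i]
      simp
      ring)
  have hOO : O * Oᵀ = 1 := mul_eq_one_comm.mp hO
  have cmul : ∀ X Y, cx (X * Y) = cx X * cx Y := fun X Y => by
    ext i j; simp [Matrix.mul_apply]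
  have cone : cx 1 = 1 := by ext i j; simp [Matrix.one_apply, apply_ite]
  have cO : cx Oᵀ * cx O = 1 := by rw [← cmul, hO, cone]
  have cOO : cx O * cx Oᵀ = 1 := by rw [← cmul, hOO, cone]
  have cOt : (cx O)ᵀ = cx Oᵀ := rfl
  have cOh : (cx O)ᴴ = cx Oᵀ := by ext i j; simp
  set e : Fin 4 → ℂ := fun k => a k + b k * I with he
  have hWO : W * cx O = cx O * diagonal e := by
    ext i j
    have h1 := congrFun (congrFun hAO i) j
    have h2 := congrFun (congrFun hBO i) j
    rw [Matrix.mul_diagonal, Matrix.mul_apply] at h1 h2 ⊢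
    apply Complex.ext
    · simpa [he, Complex.re_sum] using h1
    · simpa [he, Complex.im_sum] using h2
  have hE : diagonal e = cx Oᵀ * W * cx O := by
    rw [Matrix.mul_assoc, hWO, ← Matrix.mul_assoc, cO, Matrix.one_mul]
  have hEu : (diagonal e)ᴴ * diagonal e = 1 := by
    calc _ = (cx O)ᴴ * (Wᴴ * ((cx Oᵀ)ᴴ * cx Oᵀ) * W) * cx O := by
          rw [hE]; simp only [Matrix.conjTranspose_mul, Matrix.mul_assoc]
      _ = 1 := by
          have : (cx Oᵀ)ᴴ = cx O := by ext i j; simp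
          rw [this, cOO, Matrix.mul_one, hWu, Matrix.mul_one, cOh, cO]
  have hen : ∀ k, ‖e k‖ = 1 := by
    intro k
    have h := congrFun (congrFun hEu k) k
    rw [Matrix.diagonal_conjTranspose, Matrix.diagonal_mul_diagonal] at h
    simp only [Matrix.diagonal_apply_eq, Matrix.one_apply_eq, Pi.star_apply, RCLike.star_def] at h
    rw [← Complex.normSq_eq_conj_mul_self, Complex.normSq_eq_norm_sq] at h
    have h' : ‖e k‖ ^ 2 = 1 := by exact_mod_cast h
    nlinarith [norm_nonneg (e k)]
  obtain ⟨d, hd, hde⟩ : ∃ d : Fin 4 → ℂ, (∀ k, ‖d k‖ = 1) ∧ ∀ k, d k * d k = e k := by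
    refine ⟨fun k => Complex.exp (((Complex.arg (e k) / 2 : ℝ) : ℂ) * I),
      fun k => Complex.norm_exp_ofReal_mul_I _, fun k => ?_⟩
    have h := Complex.norm_mul_exp_arg_mul_I (e k)
    rw [hen k, Complex.ofReal_one, one_mul] at h
    rw [← Complex.exp_add, ← add_mul, ← Complex.ofReal_add, add_halves, h]
  have hdd : ∀ k, star (d k) * d k = 1 := by
    intro k
    rw [RCLike.star_def, ← Complex.normSq_eq_conj_mul_self, Complex.normSq_eq_norm_sq, hd]
    simp
  set P := V * cx O * diagonal (star d) with hP
  have hPh : Pᴴ * P = 1 := by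
    calc Pᴴ * P = diagonal d * ((cx O)ᴴ * (Vᴴ * V) * cx O) * diagonal (star d) := by
          simp only [hP, Matrix.conjTranspose_mul, Matrix.diagonal_conjTranspose, star_star,
            Matrix.mul_assoc]
      _ = 1 := by
          rw [hV, Matrix.mul_one, cOh, cO, Matrix.mul_one, Matrix.diagonal_mul_diagonal,
            ← Matrix.diagonal_one]
          congr 1
          funext k
          rw [mul_comm]; exact hdd k
  have hPt : Pᵀ * P = 1 := by
    calc Pᵀ * P = diagonal (star d) * (cx Oᵀ * W * cx O) * diagonal (star d) := by
          simp only [hP, hWdef, Matrix.transpose_mul, Matrix.diagonal_transpose, cOt,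
            Matrix.mul_assoc]
      _ = 1 := by
          rw [← hE, Matrix.diagonal_mul_diagonal, Matrix.diagonal_mul_diagonal,
            ← Matrix.diagonal_one]
          congr 1
          funext k
          rw [← hde k, Pi.star_apply]
          linear_combination (star (d k) * d k + 1) * hdd k
  have hPP : Pᵀ = Pᴴ := by
    have h : P * Pᴴ = 1 := mul_eq_one_comm.mp hPh
    calc Pᵀ = Pᵀ * (P * Pᴴ) := by rw [h, Matrix.mul_one]
      _ = Pᴴ := by rw [← Matrix.mul_assoc, hPt, Matrix.one_mul]
  have hPr : cx (P.map Complex.re) = P := by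
    ext i j
    have h := congrFun (congrFun hPP j) i
    rw [Matrix.transpose_apply, Matrix.conjTranspose_apply, RCLike.star_def] at h
    exact Complex.conj_eq_iff_re.mp h.symm
  refine ⟨P.map Complex.re, O, ?_, hO, d, hd, ?_⟩
  · have h : cx ((P.map Complex.re)ᵀ * P.map Complex.re) = cx 1 := by
      rw [cmul, cone, hPr]
      have : cx (P.map Complex.re)ᵀ = Pᵀ := by
        conv_rhs => rw [← hPr]
        rfl
      rw [this, hPt]
    ext i j
    exact Complex.ofReal_injective (congrFun (congrFun h i) j)
  · rw [hPr, hP]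
    have : diagonal (star d) * diagonal d = 1 := by
      rw [Matrix.diagonal_mul_diagonal, ← Matrix.diagonal_one]
      congr 1
      funext k
      exact hdd k
    rw [Matrix.mul_assoc (V * cx O), this, Matrix.mul_one, Matrix.mul_assoc, cOO, Matrix.mul_one]

/-- Proposition 3 of the paper (Kraus–Cirac decomposition): every two-qubit unitary can be
written as U = (R₁⊗S₁) Ω (R₂⊗S₂) with R₁,S₁,R₂,S₂ single-qubit unitaries and Ω diagonal
in the magic basis. -/
theorem magic_basis_decomposition (U : Matrix (Fin 2 × Fin 2) (Fin 2 × Fin 2) ℂ)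
    (hU : U ∈ Matrix.unitaryGroup (Fin 2 × Fin 2) ℂ) :
    ∃ R₁ ∈ Matrix.unitaryGroup (Fin 2) ℂ, ∃ S₁ ∈ Matrix.unitaryGroup (Fin 2) ℂ,
    ∃ R₂ ∈ Matrix.unitaryGroup (Fin 2) ℂ, ∃ S₂ ∈ Matrix.unitaryGroup (Fin 2) ℂ,
    ∃ φ : Fin 4 → ℝ,
      U = (R₁ ⊗ₖ S₁) * magicDiag φ * (R₂ ⊗ₖ S₂) := by
  have hV : (MMᴴ * U * MM)ᴴ * (MMᴴ * U * MM) = 1 := by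
    rw [Matrix.mem_unitaryGroup_iff', star_eq_conjTranspose] at hU
    calc _ = MMᴴ * (Uᴴ * (MM * MMᴴ) * U) * MM := by
          simp only [Matrix.conjTranspose_mul, Matrix.conjTranspose_conjTranspose, Matrix.mul_assoc]
      _ = 1 := by rw [MM_right, Matrix.mul_one, hU, Matrix.mul_one, MM_left]
  obtain ⟨O₁, O₂, h1, h2, d, hd, hdec⟩ := decomp _ hV
  obtain ⟨s, hs, R₁, hR₁, S₁, hS₁, e1⟩ := so4 O₁ h1
  obtain ⟨t, ht, R₂, hR₂, S₂, hS₂, e2⟩ := so4 O₂ h2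
  have hn : ∀ k, ‖(s k : ℂ) * d k * t k‖ = 1 := by
    intro k
    have a1 : |s k| = 1 := by
      rcases mul_self_eq_one_iff.mp (hs k) with h | h <;> simp [h]
    have a2 : |t k| = 1 := by
      rcases mul_self_eq_one_iff.mp (ht k) with h | h <;> simp [h]
    simp [hd, a1, a2]
  refine ⟨R₁, hR₁, S₁, hS₁, R₂ᴴ, Unitary.star_mem hR₂, S₂ᴴ, Unitary.star_mem hS₂,
    fun k => Complex.arg ((s k : ℂ) * d k * t k), ?_⟩
  have hD : (fun k => Complex.exp (I * (Complex.arg ((s k : ℂ) * d k * t k) : ℝ))) =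
      fun k => (s k : ℂ) * d k * t k := by
    funext k
    have := Complex.norm_mul_exp_arg_mul_I ((s k : ℂ) * d k * t k)
    rw [hn k] at this
    rw [mul_comm I]
    simpa using this
  have e2' := congrArg Matrix.conjTranspose e2
  rw [Matrix.conjTranspose_kronecker] at e2'
  rw [magicDiag_eq, hD, ← e1, ← e2']
  have hcore : cx (O₁ * diagonal s) * diagonal (fun k => (s k : ℂ) * d k * t k)
      * (cx (O₂ * diagonal t))ᴴ = MMᴴ * U * MM := by
    rw [hdec]
    have c1 : cx (O₁ * diagonal s) = cx O₁ * diagonal (fun k => (s k : ℂ)) := by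
      ext i j; simp [Matrix.mul_diagonal]
    have c2 : (cx (O₂ * diagonal t))ᴴ = diagonal (fun k => (t k : ℂ)) * cx O₂ᵀ := by
      ext i j; simp [Matrix.mul_diagonal, Matrix.diagonal_mul, mul_comm]
    rw [c1, c2]
    have c3 : diagonal d = diagonal (fun k => (s k : ℂ)) * diagonal (fun k => (s k : ℂ) * d k * t k)
        * diagonal (fun k => (t k : ℂ)) := by
      rw [Matrix.diagonal_mul_diagonal, Matrix.diagonal_mul_diagonal]
      congr 1
      funext k
      have a1 : (s k : ℂ) * s k = 1 := by exact_mod_cast hs k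
      have a2 : (t k : ℂ) * t k = 1 := by exact_mod_cast ht k
      linear_combination (-(d k) * t k * t k) * a1 - d k * a2
    rw [c3]
    simp only [Matrix.mul_assoc]
  calc U = (MM * MMᴴ) * U * (MM * MMᴴ) := by rw [MM_right, Matrix.one_mul, Matrix.mul_one]
    _ = MM * (MMᴴ * U * MM) * MMᴴ := by simp only [Matrix.mul_assoc]
    _ = MM * cx (O₁ * diagonal s) * (MMᴴ * MM) * diagonal (fun k => (s k : ℂ) * d k * t k)
        * (MMᴴ * MM) * (cx (O₂ * diagonal t))ᴴ * MMᴴ := by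
          rw [← hcore, MM_left]; simp only [Matrix.mul_assoc, Matrix.mul_one, Matrix.one_mul]
    _ = _ := by
          simp only [Matrix.conjTranspose_mul, Matrix.conjTranspose_conjTranspose, Matrix.mul_assoc]

end
end
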